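/- Let n be an odd positive integer, d an odd positive integer, and b ∈ ℤ^d. Then g_n(b) = (G_n(1))^d · G_n(χ, −b·b), i.e., Σ_{0 ≤ k < n, gcd(k,n)=1} Σ_{x ∈ {0,...,n-1}^d} e_n(b·x + k(x·x)) = (Σ_{k=0}^{n-1} e_n(k²))^d · Σ_{k=0}^{n-1} (k|n) e_n(−(b·b)k), where (k|n) is the Jacobi symbol. -/

import Mathlib

open Finset

/-- `en n x = exp(2πi x / n)` -/
noncomputable def en (n : ℕ) (x : ℤ) : ℂ := Complex.exp (2 * Real.pi * Complex.I * x / n)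

/-- `g_n(b) = Σ_{0 ≤ k < n, gcd(k,n)=1} Σ_{x ∈ {0,…,n-1}^d} e_n(b·x + k(x·x))`. -/
noncomputable def gsum (n d : ℕ) (b : Fin d → ℤ) : ℂ :=
  ∑ k ∈ (Finset.range n).filter (fun k => Nat.gcd k n = 1),
    ∑ x ∈ Fintype.piFinset fun _ : Fin d => Finset.Ico (0:ℤ) n,
      en n (∑ i, b i * x i + k * ∑ i, x i ^ 2)

/-- The Gauss sum `G_m(c) = Σ_{j=0}^{m-1} e_m(c j²)`. -/
noncomputable def gauss (m : ℕ) (c : ℤ) : ℂ := ∑ j ∈ Finset.range m, en m (c * j ^ 2)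

/-- The Gauss character sum `G_n(χ, c) = Σ_{k=0}^{n-1} (k|n) e_n(ck)` with the Jacobi symbol. -/
noncomputable def gaussChi (n : ℕ) (c : ℤ) : ℂ :=
  ∑ k ∈ Finset.range n, (jacobiSym k n : ℂ) * en n (c * k)

lemma en_eq_stdAddChar (n : ℕ) [NeZero n] (x : ℤ) :
    en n x = ZMod.stdAddChar (x : ZMod n) := by
  rw [ZMod.stdAddChar_coe, en]

lemma en_add (n : ℕ) (x y : ℤ) : en n (x + y) = en n x * en n y := by
  simp only [en, ← Complex.exp_add]
  congr 1
  push_cast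
  ring

lemma en_zero (n : ℕ) : en n 0 = 1 := by simp [en]

lemma en_sum (n : ℕ) {ι : Type*} (s : Finset ι) (f : ι → ℤ) :
    en n (∑ i ∈ s, f i) = ∏ i ∈ s, en n (f i) := by
  induction s using Finset.cons_induction with
  | empty => simp [en_zero]
  | cons a s ha ih => rw [sum_cons, prod_cons, en_add, ih]

lemma en_mul_left {m : ℕ} (hm : m ≠ 0) (n : ℕ) (x : ℤ) : en (m * n) (m * x) = en n x := by
  have : (m : ℂ) ≠ 0 := by exact_mod_cast hm
  simp only [en]
  congr 1
  push_cast
  rw [show 2 * (Real.pi : ℂ) * Complex.I * (m * x) = m * (2 * Real.pi * Complex.I * x) by ring,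
    mul_div_mul_left _ _ this]

/-- A sum over a complete system of residues mod `n` is a sum over `ZMod n`. -/
lemma sum_residues_eq_sum_zmod {n : ℕ} [NeZero n] {ι : Type*} (s : Finset ι) (φ : ι → ℤ)
    (hcard : #s = n) (hinj : ∀ i ∈ s, ∀ j ∈ s, (φ i : ZMod n) = φ j → i = j)
    (f : ZMod n → ℂ) : ∑ i ∈ s, f (φ i) = ∑ z, f z := by
  classical
  have himage : s.image (fun i => (φ i : ZMod n)) = univ := by
    rw [← card_eq_iff_eq_univ, card_image_of_injOn (fun i hi j hj => hinj i hi j hj), hcard,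
      ZMod.card]
  rw [← himage, sum_image (fun i hi j hj => hinj i hi j hj)]

lemma eq_of_natCast_zmod_eq {n a b : ℕ} (ha : a < n) (hb : b < n) (h : (a : ZMod n) = b) :
    a = b := by
  rwa [ZMod.natCast_eq_natCast_iff', Nat.mod_eq_of_lt ha, Nat.mod_eq_of_lt hb] at h

lemma sum_range_eq_sum_zmod {n : ℕ} [NeZero n] (f : ZMod n → ℂ) :
    ∑ j ∈ range n, f j = ∑ z, f z := by
  have := sum_residues_eq_sum_zmod (range n) (fun j => (j : ℤ)) (card_range n)
    (fun i hi j hj h => eq_of_natCast_zmod_eq (mem_range.1 hi) (mem_range.1 hj) (by simpa using h)) f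
  simpa using this

lemma sum_Ico_eq_sum_zmod {n : ℕ} [NeZero n] (f : ZMod n → ℂ) :
    ∑ j ∈ Ico (0 : ℤ) n, f j = ∑ z, f z := by
  refine sum_residues_eq_sum_zmod (Ico (0 : ℤ) n) (fun j => j) (by simp) ?_ f
  intro i hi j hj h
  rw [mem_Ico] at hi hj
  rw [ZMod.intCast_eq_intCast_iff'] at h
  rwa [Int.emod_eq_of_lt hi.1 hi.2, Int.emod_eq_of_lt hj.1 hj.2] at h

lemma gauss_eq_sum_zmod (n : ℕ) [NeZero n] (c : ℤ) :
    gauss n c = ∑ z : ZMod n, ZMod.stdAddChar ((c : ZMod n) * z ^ 2) := by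
  rw [← sum_range_eq_sum_zmod fun z => ZMod.stdAddChar ((c : ZMod n) * z ^ 2)]
  simp [gauss, en_eq_stdAddChar]

lemma sum_en_mul (n : ℕ) [NeZero n] (c : ℤ) :
    ∑ j ∈ range n, en n (c * j) = if (n : ℤ) ∣ c then (n : ℂ) else 0 := by
  have h := AddChar.sum_mulShift (c : ZMod n) (ZMod.isPrimitive_stdAddChar n)
  rw [← sum_range_eq_sum_zmod (fun z => ZMod.stdAddChar (z * (c : ZMod n))), ZMod.card] at h
  simp only [ZMod.intCast_zmod_eq_zero_iff_dvd] at h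
  rw [← Nat.cast_zero, ← apply_ite Nat.cast, ← h]
  simp [en_eq_stdAddChar, mul_comm]

lemma gauss_mul_of_coprime {m n : ℕ} [NeZero m] [NeZero n] (hmn : m.Coprime n) (k : ℤ) :
    gauss (m * n) k = gauss m (k * n) * gauss n (k * m) := by
  have hinj : ∀ i ∈ range m ×ˢ range n, ∀ j ∈ range m ×ˢ range n,
      (((n * i.1 + m * i.2 : ℤ)) : ZMod (m * n)) = ((n * j.1 + m * j.2 : ℤ)) → i = j := by
    rintro ⟨y, z⟩ hi ⟨y', z'⟩ hj h
    simp only [mem_product, mem_range] at hi hj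
    rw [ZMod.intCast_eq_intCast_iff_dvd_sub] at h
    push_cast at h
    have h1 : (m : ℤ) ∣ y' - y := by
      have : (m : ℤ) ∣ n * (y' - y) := by
        obtain ⟨c, hc⟩ := h
        exact ⟨n * c - (z' - z), by linear_combination hc⟩
      exact (Nat.isCoprime_iff_coprime.2 hmn).dvd_of_dvd_mul_left this
    have h2 : (n : ℤ) ∣ z' - z := by
      have : (n : ℤ) ∣ m * (z' - z) := by
        obtain ⟨c, hc⟩ := h
        exact ⟨m * c - (y' - y), by linear_combination hc⟩
      exact (Nat.isCoprime_iff_coprime.2 hmn.symm).dvd_of_dvd_mul_left this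
    have h3 : y = y' := eq_of_natCast_zmod_eq hi.1 hj.1
      (by exact_mod_cast (ZMod.intCast_eq_intCast_iff_dvd_sub y y' m).2 h1)
    have h4 : z = z' := eq_of_natCast_zmod_eq hi.2 hj.2
      (by exact_mod_cast (ZMod.intCast_eq_intCast_iff_dvd_sub z z' n).2 h2)
    rw [h3, h4]
  rw [gauss_eq_sum_zmod, ← sum_residues_eq_sum_zmod (range m ×ˢ range n)
    (fun i => (n * i.1 + m * i.2 : ℤ)) (by simp) hinj, gauss, gauss, sum_mul_sum, sum_product]
  refine sum_congr rfl fun y _ => sum_congr rfl fun z _ => ?_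
  rw [← en_mul_left (NeZero.ne n) m, ← en_mul_left (NeZero.ne m) n, mul_comm n m, ← en_add,
    en_eq_stdAddChar]
  congr 1
  have h0 : (m : ZMod (m * n)) * n = 0 := by exact_mod_cast ZMod.natCast_self (m * n)
  push_cast
  linear_combination (2 * k * y * z : ZMod (m * n)) * h0

lemma gauss_sq_mul {p m : ℕ} [NeZero p] [NeZero m] (k : ℤ) (hk : IsCoprime (p : ℤ) (2 * k)) :
    gauss (p * (p * m)) k = p * gauss m k := by
  have hp : 0 < p := NeZero.pos p
  have hm : 0 < m := NeZero.pos m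
  have hinj : ∀ i ∈ range (p * m) ×ˢ range p, ∀ j ∈ range (p * m) ×ˢ range p,
      (((i.1 + p * m * i.2 : ℤ)) : ZMod (p * (p * m))) = ((j.1 + p * m * j.2 : ℤ)) → i = j := by
    have hlt : ∀ y z : ℕ, y < p * m → z < p → y + p * m * z < p * (p * m) := fun y z hy hz =>
      calc y + p * m * z < p * m * (z + 1) := by linarith
        _ ≤ p * m * p := Nat.mul_le_mul_left _ hz
        _ = p * (p * m) := mul_comm _ _
    rintro ⟨y, z⟩ hi ⟨y', z'⟩ hj h
    simp only [mem_product, mem_range] at hi hj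
    have h' : y + p * m * z = y' + p * m * z' :=
      eq_of_natCast_zmod_eq (hlt _ _ hi.1 hi.2) (hlt _ _ hj.1 hj.2) (by push_cast at h ⊢; exact h)
    have h1 : y = y' := by
      have := congrArg (· % (p * m)) h'
      simpa [Nat.add_mul_mod_self_left, Nat.mod_eq_of_lt hi.1, Nat.mod_eq_of_lt hj.1] using this
    subst h1
    have := Nat.eq_of_mul_eq_mul_left (Nat.mul_pos hp hm) (Nat.add_left_cancel h')
    rw [this]
  have hterm : ∀ y z : ℕ, ZMod.stdAddChar
      ((k : ZMod (p * (p * m))) * ((y + p * m * z : ℤ) : ZMod (p * (p * m))) ^ 2) =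
      en (p * (p * m)) (k * y ^ 2) * en p (2 * k * y * z) := by
    intro y z
    rw [← en_mul_left (NeZero.ne (p * m)) p, mul_comm (p * m) p, ← en_add, en_eq_stdAddChar]
    congr 1
    have h0 : (p : ZMod (p * (p * m))) * (p * m) = 0 := by
      exact_mod_cast ZMod.natCast_self (p * (p * m))
    push_cast
    linear_combination (k * m * z ^ 2 : ZMod (p * (p * m))) * h0
  have hfilter : (range (p * m)).filter (fun y => p ∣ y) = (range m).image (p * ·) := by
    ext y
    simp only [mem_filter, mem_image, mem_range]
    constructor
    · rintro ⟨hy, w, rfl⟩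
      exact ⟨w, lt_of_mul_lt_mul_left hy hp.le, rfl⟩
    · rintro ⟨w, hw, rfl⟩
      exact ⟨Nat.mul_lt_mul_of_pos_left hw hp, dvd_mul_right _ _⟩
  have hdvd : ∀ y : ℕ, (p : ℤ) ∣ 2 * k * y ↔ p ∣ y := fun y =>
    ⟨fun h => by exact_mod_cast hk.dvd_of_dvd_mul_left h,
      fun h => Dvd.dvd.mul_left (by exact_mod_cast h) _⟩
  rw [gauss_eq_sum_zmod, ← sum_residues_eq_sum_zmod (range (p * m) ×ˢ range p)
    (fun i => (i.1 + p * m * i.2 : ℤ)) (by simp [mul_comm]) hinj, sum_product]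
  simp only [hterm, ← mul_sum, sum_en_mul, hdvd, mul_ite, mul_zero]
  rw [← sum_filter, hfilter, sum_image (fun a _ b _ h => Nat.eq_of_mul_eq_mul_left hp h), gauss,
    mul_sum]
  refine sum_congr rfl fun w _ => ?_
  rw [mul_comm, ← en_mul_left (NeZero.ne p) m, ← en_mul_left (NeZero.ne p) (p * m)]
  congr 2
  push_cast
  ring

lemma gauss_prime_eq_gaussSum {p : ℕ} [Fact p.Prime] (hp : p ≠ 2) {k : ℤ}
    (hk : IsCoprime k p) :
    gauss p k = jacobiSym k p *
      gaussSum ((quadraticChar (ZMod p)).ringHomComp (Int.castRingHom ℂ)) ZMod.stdAddChar := by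
  have hku : IsUnit (k : ZMod p) := (ZMod.coe_int_isUnit_iff_isCoprime k p).2 hk.symm
  have hchar : ringChar (ZMod p) ≠ 2 := by rwa [ZMod.ringChar_zmod_n]
  set χ := (quadraticChar (ZMod p)).ringHomComp (Int.castRingHom ℂ)
  have hcard : ∀ a : ZMod p, (#{x : ZMod p | x ^ 2 = a} : ℂ) = χ a + 1 := by
    intro a
    have := quadraticChar_card_sqrts hchar a
    rw [Set.toFinset_ofPred] at this
    have := congrArg (Int.cast : ℤ → ℂ) this
    push_cast at this
    exact this
  have hsum : ∑ a : ZMod p, ZMod.stdAddChar ((k : ZMod p) * a) = (0 : ℂ) := by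
    have := AddChar.sum_mulShift (k : ZMod p) (ZMod.isPrimitive_stdAddChar p)
    rw [if_neg hku.ne_zero, Nat.cast_zero] at this
    simpa only [mul_comm] using this
  have hshift := gaussSum_mulShift χ ZMod.stdAddChar hku.unit
  have hχ : χ (k : ZMod p) = jacobiSym k p := by
    rw [← jacobiSym.legendreSym.to_jacobiSym]
    rfl
  have hsq : (jacobiSym k p : ℂ) * jacobiSym k p = 1 := by
    exact_mod_cast (sq _).symm.trans (jacobiSym.sq_one (Int.isCoprime_iff_gcd_eq_one.1 hk))
  rw [IsUnit.unit_spec, hχ] at hshift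
  rw [← hshift, ← mul_assoc, hsq, one_mul, gauss_eq_sum_zmod,
    ← sum_fiberwise' univ (fun x : ZMod p => x ^ 2) (fun a => ZMod.stdAddChar ((k : ZMod p) * a))]
  simp only [sum_const, nsmul_eq_mul, hcard, add_mul, one_mul, sum_add_distrib, hsum, add_zero]
  rfl

lemma gauss_eq_jacobiSym_mul {n : ℕ} (hn : Odd n) {k : ℤ} (hk : IsCoprime k n) :
    gauss n k = jacobiSym k n * gauss n 1 := by
  induction n using Nat.strong_induction_on generalizing k with
  | _ n ih =>
  obtain rfl | h1 := eq_or_ne n 1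
  · simp [gauss, en_zero]
  obtain ⟨p, hp, m, rfl⟩ := Nat.exists_prime_and_dvd h1
  obtain ⟨hpo, hmo⟩ := Nat.odd_mul.1 hn
  have : Fact p.Prime := ⟨hp⟩
  have : NeZero m := ⟨hmo.pos.ne'⟩
  have hp2 : p ≠ 2 := by rintro rfl; exact absurd hpo (by decide)
  have hpcop : IsCoprime (p : ℤ) 2 := by
    exact_mod_cast Nat.isCoprime_iff_coprime.2 hpo.coprime_two_right
  have hkp : IsCoprime k p := hk.of_isCoprime_of_dvd_right (by simp)
  have hkm : IsCoprime k m := hk.of_isCoprime_of_dvd_right (by simp)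
  by_cases hpm : p ∣ m
  · obtain ⟨m, rfl⟩ := hpm
    have hmo' := (Nat.odd_mul.1 hmo).2
    have : NeZero m := ⟨hmo'.pos.ne'⟩
    have hlt : m < p * (p * m) :=
      (lt_mul_of_one_lt_left hmo'.pos hp.one_lt).trans
        (lt_mul_of_one_lt_left hmo.pos hp.one_lt)
    rw [gauss_sq_mul k (hpcop.mul_right hkp.symm), gauss_sq_mul 1 (by simpa using hpcop),
      ih m hlt hmo' (hkm.of_isCoprime_of_dvd_right (by simp)), jacobiSym.mul_right,
      jacobiSym.mul_right, ← mul_assoc (jacobiSym k p), ← sq,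
      jacobiSym.sq_one (Int.isCoprime_iff_gcd_eq_one.1 hkp), one_mul]
    ring
  · have hcop : p.Coprime m := (hp.coprime_iff_not_dvd).2 hpm
    have hpm' : IsCoprime (p : ℤ) m := Nat.isCoprime_iff_coprime.2 hcop
    have hlt : m < p * m := by nlinarith [hp.two_le, hmo.pos]
    rw [gauss_mul_of_coprime hcop, gauss_mul_of_coprime hcop,
      gauss_prime_eq_gaussSum hp2 (hkp.mul_left hpm'.symm),
      gauss_prime_eq_gaussSum hp2 (isCoprime_one_left.mul_left hpm'.symm),
      ih m hlt hmo (hkm.mul_left hpm'), ih m hlt hmo (isCoprime_one_left.mul_left hpm'),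
      jacobiSym.mul_right, jacobiSym.mul_left, jacobiSym.mul_left, one_mul, one_mul]
    push_cast
    ring

/-- Completing the square, where `l` plays the role of the inverse of `4 k`. -/
lemma sum_en_quadratic {n : ℕ} [NeZero n] {k l : ℤ} (h : (4 * k * l : ZMod n) = 1) (b : ℤ) :
    ∑ x ∈ Ico (0 : ℤ) n, en n (b * x + k * x ^ 2) = en n (-b ^ 2 * l) * gauss n k := by
  rw [gauss_eq_sum_zmod, ← Equiv.sum_comp (Equiv.addRight (2 * l * b : ZMod n)), mul_sum,
    ← sum_Ico_eq_sum_zmod]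
  refine sum_congr rfl fun x _ => ?_
  rw [en_eq_stdAddChar, en_eq_stdAddChar, ← AddChar.map_add_eq_mul]
  congr 1
  rw [Equiv.coe_addRight]
  push_cast
  linear_combination -(b * x + b ^ 2 * l : ZMod n) * h

lemma isCoprime_of_four_mul_mul_eq_one {n : ℕ} {k l : ℤ} (h : (4 * k * l : ZMod n) = 1) :
    IsCoprime k n :=
  ((ZMod.coe_int_isUnit_iff_isCoprime k n).1 <|
    IsUnit.of_mul_eq_one (4 * l : ZMod n) (by rw [← h]; ring)).symm

lemma jacobiSym_eq_of_four_mul_mul_eq_one {n : ℕ} (hn : Odd n) {k l : ℤ}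
    (h : (4 * k * l : ZMod n) = 1) : jacobiSym k n = jacobiSym l n := by
  have hprod : jacobiSym (4 * k * l) n = jacobiSym 1 n :=
    jacobiSym.mod_left' ((ZMod.intCast_eq_intCast_iff' _ _ n).1 (by push_cast; exact h))
  have hsq := jacobiSym.sq_one
    (Int.isCoprime_iff_gcd_eq_one.1 (isCoprime_of_four_mul_mul_eq_one h))
  rw [jacobiSym.mul_left, jacobiSym.mul_left, jacobiSym.at_four hn, jacobiSym.one_left,
    one_mul] at hprod
  linear_combination jacobiSym l n * hsq - jacobiSym k n * hprod

lemma sum_piFinset_en_quadratic {n d : ℕ} (hn : Odd n) (hd : Odd d) {k l : ℤ}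
    (h : (4 * k * l : ZMod n) = 1) (b : Fin d → ℤ) :
    ∑ x ∈ Fintype.piFinset fun _ : Fin d => Ico (0 : ℤ) n,
      en n (∑ i, b i * x i + k * ∑ i, x i ^ 2) =
    gauss n 1 ^ d * (jacobiSym l n * en n (-(∑ i, b i ^ 2) * l)) := by
  have : NeZero n := ⟨hn.pos.ne'⟩
  have hk := isCoprime_of_four_mul_mul_eq_one h
  have hpow : jacobiSym k n ^ d = jacobiSym k n := by
    obtain ⟨e, rfl⟩ := hd
    rw [pow_succ, pow_mul, jacobiSym.sq_one (Int.isCoprime_iff_gcd_eq_one.1 hk), one_pow, one_mul]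
  simp only [mul_sum, ← sum_add_distrib, en_sum]
  rw [← prod_univ_sum (fun _ : Fin d => Ico (0 : ℤ) n) fun i x => en n (b i * x + k * x ^ 2)]
  simp only [sum_en_quadratic h, prod_mul_distrib, ← en_sum, prod_const, card_univ,
    Fintype.card_fin, gauss_eq_jacobiSym_mul hn hk]
  rw [← sum_mul, sum_neg_distrib, ← jacobiSym_eq_of_four_mul_mul_eq_one hn h]
  have : (jacobiSym k n : ℂ) ^ d = jacobiSym k n := by exact_mod_cast hpow
  rw [this]
  ring

lemma gaussChi_eq_sum_filter (n : ℕ) (c : ℤ) :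
    gaussChi n c = ∑ k ∈ (range n).filter (fun k => Nat.gcd k n = 1),
      (jacobiSym k n : ℂ) * en n (c * k) := by
  refine (sum_filter_of_ne fun k hk hne => ?_).symm
  by_contra hgcd
  refine hne ?_
  rw [jacobiSym.eq_zero_iff.2 ⟨fun h => by simp [h] at hk, by simpa using hgcd⟩]
  simp

/-- For `n` odd and `d` odd, `g_n(b) = (G_n(1))^d · G_n(χ, −b·b)`. -/
theorem gsum_eq_gauss_pow_mul_gaussChi (n d : ℕ) (hn : 0 < n) (hnodd : Odd n)
    (hd : 0 < d) (hdodd : Odd d) (b : Fin d → ℤ) :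
    gsum n d b = (gauss n 1) ^ d * gaussChi n (-(∑ i, b i ^ 2)) := by
  have : NeZero n := ⟨hn.ne'⟩
  have hinv : ∀ k : ℕ, Nat.gcd k n = 1 →
      4 * (k : ZMod n) * (((4 * k : ZMod n)⁻¹).val : ZMod n) = 1 := by
    intro k hk
    have h4 : Nat.Coprime (4 * k) n :=
      Nat.Coprime.mul_left (hnodd.coprime_two_left.pow_left 2) hk
    have := ZMod.coe_mul_inv_eq_one (4 * k) h4
    push_cast at this
    rwa [ZMod.natCast_val, ZMod.cast_id]
  have hmem : ∀ k ∈ (range n).filter (fun k => Nat.gcd k n = 1),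
      ((4 * k : ZMod n)⁻¹).val ∈ (range n).filter (fun k => Nat.gcd k n = 1) := by
    intro k hk
    rw [mem_filter, mem_range] at hk ⊢
    refine ⟨ZMod.val_lt _, Nat.isCoprime_iff_coprime.1 ?_⟩
    refine isCoprime_of_four_mul_mul_eq_one (l := k) ?_
    rw [← hinv k hk.2]
    push_cast
    ring
  have hinvol : ∀ k ∈ (range n).filter (fun k => Nat.gcd k n = 1),
      ((4 * (((4 * k : ZMod n)⁻¹).val : ZMod n))⁻¹).val = k := by
    intro k hk
    have hk' := hmem k hk
    rw [mem_filter, mem_range] at hk hk'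
    refine eq_of_natCast_zmod_eq (ZMod.val_lt _) hk.1 ?_
    have e1 := hinv k hk.2
    have e2 := hinv _ hk'.2
    linear_combination (-(((4 * (((4 * k : ZMod n)⁻¹).val : ZMod n))⁻¹).val : ZMod n)) * e1 + k * e2
  rw [gaussChi_eq_sum_filter, mul_sum, gsum]
  refine sum_nbij' (fun k => ((4 * k : ZMod n)⁻¹).val) (fun k => ((4 * k : ZMod n)⁻¹).val)
    hmem hmem hinvol hinvol fun k hk => ?_
  refine sum_piFinset_en_quadratic hnodd hdodd ?_ b
  simpa using hinv k (mem_filter.1 hk).2
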